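/- Let G and H be groups of nilpotence class two and f : G → H a q-map. Then f([G,G]) ⊆ [H,H], and the restriction of f to the commutator subgroup gives a group homomorphism [f,f] : [G,G] → [H,H]. Together with the induced homomorphism f_ab : G_ab → H_ab, one gets a commutative ladder between the central extensions 1 → [G,G] → G → G_ab → 1 and 1 → [H,H] → H → H_ab → 1 (i.e. the restriction and abelianization of f are compatible with the inclusion and projection maps). -/

import Mathlib

/-- The cross-effect of a map between groups: `(a|b)_f = (f a * f b)⁻¹ * f (a*b)`. -/
def crossEff {G H : Type*} [Group G] [Group H] (f : G → H) (a b : G) : H :=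
  (f a * f b)⁻¹ * f (a * b)

/-- The commutator `[a,b] = a⁻¹ * b⁻¹ * a * b`. -/
def cmt {G : Type*} [Group G] (a b : G) : G := a⁻¹ * b⁻¹ * a * b

/-- A map between groups is weakly quadratic if its cross-effect commutes with all values
of `f` and is multiplicative in each variable. -/
def IsWeaklyQuadratic {G H : Type*} [Group G] [Group H] (f : G → H) : Prop :=
  (∀ a b c : G, Commute (crossEff f a b) (f c)) ∧
  (∀ a a' b : G, crossEff f (a * a') b = crossEff f a b * crossEff f a' b) ∧
  (∀ a b b' : G, crossEff f a (b * b') = crossEff f a b * crossEff f a b')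

/-- A quadratic map: weakly quadratic with central cross-effect values. -/
def IsQuadratic {G H : Type*} [Group G] [Group H] (f : G → H) : Prop :=
  IsWeaklyQuadratic f ∧ ∀ a b : G, crossEff f a b ∈ Subgroup.center H

/-- A q-map: weakly quadratic with cross-effect values in the commutator subgroup. -/
def IsQMap {G H : Type*} [Group G] [Group H] (f : G → H) : Prop :=
  IsWeaklyQuadratic f ∧ ∀ a b : G, crossEff f a b ∈ commutator H

theorem apply_mul_eq_crossEff {G H : Type*} [Group G] [Group H] (f : G → H) (a b : G) :
    f (a * b) = f a * f b * crossEff f a b := by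
  simp [crossEff, mul_assoc]

/-- The cross-effect of a weakly quadratic map with central cross-effects, as a homomorphism
in its second variable. -/
def crossEffHom {G H : Type*} [Group G] [Group H] {f : G → H} (hf : IsQuadratic f) (a : G) :
    G →* Subgroup.center H :=
  MonoidHom.mk' (fun b => ⟨crossEff f a b, hf.2 a b⟩) fun b b' =>
    Subtype.ext (hf.1.2.2 a b b')

open scoped IsMulCommutative in
theorem IsQuadratic.crossEff_eq_one {G H : Type*} [Group G] [Group H] {f : G → H}
    (hf : IsQuadratic f) (a : G) {b : G} (hb : b ∈ commutator G) : crossEff f a b = 1 := by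
  have h : crossEffHom hf a b = 1 :=
    Abelianization.commutator_subset_ker (crossEffHom hf a) hb
  exact congrArg Subtype.val h

/-- A q-map composed with the projection to the abelianization is a homomorphism. -/
def IsQMap.toAbelianization {G H : Type*} [Group G] [Group H] {f : G → H} (hf : IsQMap f) :
    G →* Abelianization H :=
  MonoidHom.mk' (fun a => Abelianization.of (f a)) fun a b => by
    have h : Abelianization.of (crossEff f a b) = 1 := by
      rw [← MonoidHom.mem_ker, Abelianization.ker_of]
      exact hf.2 a b
    rw [apply_mul_eq_crossEff f a b, map_mul, map_mul, h, mul_one]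

theorem IsQMap.apply_mem_commutator {G H : Type*} [Group G] [Group H] {f : G → H}
    (hf : IsQMap f) {c : G} (hc : c ∈ commutator G) : f c ∈ commutator H := by
  rw [← Abelianization.ker_of H]
  exact Abelianization.commutator_subset_ker hf.toAbelianization hc

theorem stmt_10 {G H : Type*} [Group G] [Group H]
    (hG : commutator G ≤ Subgroup.center G) (hH : commutator H ≤ Subgroup.center H)
    (f : G → H) (hf : IsQMap f) :
    (∀ c ∈ commutator G, f c ∈ commutator H) ∧
    ∃ (ff : ↥(commutator G) →* ↥(commutator H))
      (fab : Abelianization G →* Abelianization H),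
      (∀ c : ↥(commutator G), (ff c : H) = f (c : G)) ∧
      (∀ a : G, fab (Abelianization.of a) = Abelianization.of (f a)) := by
  have hq : IsQuadratic f := ⟨hf.1, fun a b => hH (hf.2 a b)⟩
  refine ⟨fun c hc => hf.apply_mem_commutator hc,
    MonoidHom.mk' (fun c => ⟨f c, hf.apply_mem_commutator c.2⟩) fun c d => Subtype.ext ?_,
    Abelianization.lift hf.toAbelianization, fun _ => rfl, fun _ => rfl⟩
  simpa [hq.crossEff_eq_one (c : G) d.2] using apply_mul_eq_crossEff f c d
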